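/- arXiv:1502.01269 — 3 statements merged into one kernel-verified Lean document; each statement's English description precedes it below -/
import Mathlib

section
/- Let 𝒫 be a prediction set with respect to a measure space (Ω, 𝒜, μ). A scoring rule S : 𝒫⁺ → ℒ(𝒫) is proper if and only if there exists a sublinear function Φ : 𝒫⁺ → ℝ such that S is a subgradient of Φ on 𝒫⁺ (and in that case necessarily Φ(p) = p·S(p) for all p ∈ 𝒫⁺). -/
set_option linter.unusedSectionVars false
open MeasureTheory Set Filter Topology

variable {Ω : Type*} [MeasurableSpace Ω]

/-- `P` is a prediction set with respect to `μ`: a convex set of probability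
densities on `Ω`. -/
def IsPredictionSet (μ : Measure Ω) (P : Set (Ω → ℝ)) : Prop :=
  Convex ℝ P ∧ ∀ p ∈ P, Measurable p ∧ (∀ x, 0 ≤ p x) ∧
    Integrable p μ ∧ ∫ x, p x ∂μ = 1

/-- The prediction cone `𝒫⁺ = {λ p : λ > 0, p ∈ 𝒫}`. -/
def predCone (P : Set (Ω → ℝ)) : Set (Ω → ℝ) :=
  {f | ∃ c : ℝ, 0 < c ∧ ∃ p ∈ P, f = c • p}

/-- `ℒ(𝒫)`: the `𝒫`-integrable functions. -/
def PIntegrable (μ : Measure Ω) (P : Set (Ω → ℝ)) (f : Ω → ℝ) : Prop :=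
  Measurable f ∧ ∀ p ∈ P, Integrable (fun x => |f x| * p x) μ

/-- The pairing `p · f = ∫ f p dμ`. -/
noncomputable def pairing (μ : Measure Ω) (p f : Ω → ℝ) : ℝ :=
  ∫ x, f x * p x ∂μ

/-- `Φ` is (positively) 1-homogeneous and subadditive on the cone `cone`. -/
def SublinearOn (cone : Set (Ω → ℝ)) (Φ : (Ω → ℝ) → ℝ) : Prop :=
  (∀ p ∈ cone, ∀ c : ℝ, 0 < c → Φ (c • p) = c * Φ p) ∧
  ∀ f ∈ cone, ∀ g ∈ cone, Φ (f + g) ≤ Φ f + Φ g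

/-- `p` and `q` are positively collinear. -/
def PosCollinear (p q : Ω → ℝ) : Prop := ∃ c : ℝ, 0 < c ∧ p = c • q

/-- `𝒟(q)`: the set of directions from `q` into `𝒫⁺`. -/
def dirSet (P : Set (Ω → ℝ)) (q : Ω → ℝ) : Set (Ω → ℝ) :=
  {p | p ∈ Submodule.span ℝ P ∧ ∃ ε : ℝ, 0 < ε ∧ q + ε • p ∈ predCone P}

/-- `𝒪(q) = 𝒟(q) ∩ (−𝒟(q))`. -/
def oSet (P : Set (Ω → ℝ)) (q : Ω → ℝ) : Set (Ω → ℝ) :=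
  {p | p ∈ dirSet P q ∧ -p ∈ dirSet P q}

/-- The right directional derivative `Φ′₊(p,q)` of a sublinear `Φ` at `q` along `p`,
taken in `ℝ ∪ {−∞}` (for sublinear `Φ` the limit of slopes as `t → 0⁺` exists and
equals the infimum of the slopes, which is how it is expressed here). -/
noncomputable def rderiv (P : Set (Ω → ℝ)) (Φ : (Ω → ℝ) → ℝ) (q p : Ω → ℝ) : EReal :=
  ⨅ t : {t : ℝ // 0 < t ∧ q + t • p ∈ predCone P},
    (((Φ (q + (t : ℝ) • p) - Φ q) / (t : ℝ) : ℝ) : EReal)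

lemma predCone_subset_span (P : Set (Ω → ℝ)) :
    predCone P ⊆ (Submodule.span ℝ P : Set (Ω → ℝ)) := by
  rintro f ⟨c, hc, p, hp, rfl⟩
  exact Submodule.smul_mem _ _ (Submodule.subset_span hp)

lemma add_mem_predCone {P : Set (Ω → ℝ)} (hP : Convex ℝ P) {f g : Ω → ℝ}
    (hf : f ∈ predCone P) (hg : g ∈ predCone P) : f + g ∈ predCone P := by
  obtain ⟨a, ha, p, hp, rfl⟩ := hf
  obtain ⟨b, hb, q, hq, rfl⟩ := hg
  have hab : 0 < a + b := add_pos ha hb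
  refine ⟨a + b, hab, (a / (a + b)) • p + (b / (a + b)) • q,
    hP hp hq (by positivity) (by positivity) (by field_simp), ?_⟩
  rw [smul_add, smul_smul, smul_smul, mul_div_cancel₀ _ hab.ne', mul_div_cancel₀ _ hab.ne']

lemma PIntegrable.integrable_mul {μ : Measure Ω} {P : Set (Ω → ℝ)} {f p : Ω → ℝ}
    (hf : PIntegrable μ P f) (hP : IsPredictionSet μ P) (hp : p ∈ predCone P) :
    Integrable (fun x => f x * p x) μ := by
  obtain ⟨c, -, p, hp, rfl⟩ := hp
  have hpm := (hP.2 p hp).1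
  have h : Integrable (fun x => f x * p x) μ :=
    (hf.2 p hp).mono (hf.1.mul hpm).aestronglyMeasurable
      (ae_of_all _ fun x => by simp)
  refine (h.const_mul c).congr (ae_of_all _ fun x => ?_)
  simp only [Pi.smul_apply, smul_eq_mul]
  ring

lemma pairing_smul (μ : Measure Ω) (c : ℝ) (p f : Ω → ℝ) :
    pairing μ (c • p) f = c * pairing μ p f := by
  simp only [pairing, Pi.smul_apply, smul_eq_mul, mul_left_comm _ c, integral_const_mul]

lemma pairing_add {μ : Measure Ω} {p q f : Ω → ℝ} (hp : Integrable (fun x => f x * p x) μ)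
    (hq : Integrable (fun x => f x * q x) μ) :
    pairing μ (p + q) f = pairing μ p f + pairing μ q f := by
  simp only [pairing, Pi.add_apply, mul_add]
  exact integral_add hp hq

/-- Hendrickson–Buehler. A scoring rule `S : 𝒫⁺ → ℒ(𝒫)` is proper
iff there is a sublinear `Φ : 𝒫⁺ → ℝ` such that `S` is a subgradient of `Φ` on `𝒫⁺`
(and then necessarily `Φ(p) = p ⬝ S(p)`). -/
theorem proper_iff_subgradient_of_sublinear
    (μ : Measure Ω) (P : Set (Ω → ℝ)) (hP : IsPredictionSet μ P)
    (S : (Ω → ℝ) → Ω → ℝ)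
    (hSint : ∀ q ∈ predCone P, PIntegrable μ P (S q))
    (hShom : ∀ q ∈ predCone P, ∀ c : ℝ, 0 < c → S (c • q) = S q) :
    (∀ p ∈ predCone P, ∀ q ∈ predCone P, pairing μ p (S q) ≤ pairing μ p (S p)) ↔
    ∃ Φ : (Ω → ℝ) → ℝ, SublinearOn (predCone P) Φ ∧
      ∀ q ∈ predCone P, (∀ p ∈ predCone P, pairing μ p (S q) ≤ Φ p) ∧
        pairing μ q (S q) = Φ q := by
  constructor
  · intro h
    refine ⟨fun p => pairing μ p (S p), ⟨fun p hp c hc => ?_, fun f hf g hg => ?_⟩,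
      fun q hq => ⟨fun p hp => h p hp q hq, rfl⟩⟩
    · simp only [hShom p hp c hc, pairing_smul]
    · have hfg := add_mem_predCone hP.1 hf hg
      have hS := hSint _ hfg
      simp only [pairing_add (hS.integrable_mul hP hf) (hS.integrable_mul hP hg)]
      exact add_le_add (h f hf _ hfg) (h g hg _ hfg)
  · rintro ⟨Φ, -, hΦ⟩ p hp q hq
    exact ((hΦ q hq).1 p hp).trans_eq (hΦ p hp).2.symm
end

section
/- Let Φ : 𝒫⁺ → ℝ be a sublinear function and q ∈ 𝒫⁺. If 𝒟(q) = Span 𝒫 and the two-sided directional derivative Φ′(p,q) exists and is finite for every p ∈ Span 𝒫, then the map p ↦ Φ′(p,q) is a linear functional on Span 𝒫 and ∂Φ(q) = {Φ′(·,q)}, i.e. it is the unique subgradient of Φ at q. -/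
set_option linter.unusedSectionVars false
open MeasureTheory Set Filter Topology

variable {Ω : Type*} [MeasurableSpace Ω]

lemma smul_mem_predCone {P : Set (Ω → ℝ)} {f : Ω → ℝ} (hf : f ∈ predCone P) {a : ℝ}
    (ha : 0 < a) : a • f ∈ predCone P := by
  obtain ⟨c, hc, p, hp, rfl⟩ := hf
  exact ⟨a * c, mul_pos ha hc, p, hp, smul_smul a c p⟩

lemma convex_predCone {P : Set (Ω → ℝ)} (hP : Convex ℝ P) : Convex ℝ (predCone P) :=
  convex_iff_forall_pos.2 fun _ hf _ hg _ _ ha hb _ =>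
    add_mem_predCone hP (smul_mem_predCone hf ha) (smul_mem_predCone hg hb)

/-- If both `p` and `-p` are admissible directions at `q`, then a whole neighbourhood of `q`
on the line through `q` along `p` lies in the prediction cone. -/
lemma eventually_add_smul_mem_predCone {P : Set (Ω → ℝ)} (hP : Convex ℝ P) {p q : Ω → ℝ}
    (hp : p ∈ oSet P q) : ∀ᶠ t : ℝ in 𝓝 0, q + t • p ∈ predCone P := by
  obtain ⟨⟨-, a, ha, hpa⟩, -, b, hb, hpb⟩ := hp
  have hconv : Convex ℝ {t : ℝ | q + t • p ∈ predCone P} := by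
    intro s hs t ht u v hu hv huv
    have := convex_predCone hP hs ht hu hv huv
    have e : q + (u • s + v • t) • p = u • (q + s • p) + v • (q + t • p) := by
      rw [smul_add, smul_add, add_add_add_comm, ← add_smul, huv, one_smul, add_smul,
        smul_assoc, smul_assoc]
    simpa only [mem_ofPred_eq, e] using this
  have hpb' : q + (-b) • p ∈ predCone P := by simpa using hpb
  filter_upwards [Icc_mem_nhds (neg_lt_zero.2 hb) ha] with t ht
  exact hconv.ordConnected.out hpb' hpa ht

/-- If `𝒟(q) = Span 𝒫` and the two-sided directional derivative
`Φ′(p,q)` exists (finite) for every `p ∈ Span 𝒫`, then `p ↦ Φ′(p,q)` is linear on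
`Span 𝒫` and `∂Φ(q) = {Φ′(·,q)}`: it is a subgradient of `Φ` at `q` and every
subgradient of `Φ` at `q` coincides with it. -/
theorem subdifferential_eq_singleton_of_twosided_deriv
    (μ : Measure Ω) (P : Set (Ω → ℝ)) (hP : IsPredictionSet μ P)
    (Φ : (Ω → ℝ) → ℝ) (hΦ : SublinearOn (predCone P) Φ)
    (q : Ω → ℝ) (hq : q ∈ predCone P)
    (hdir : dirSet P q = (Submodule.span ℝ P : Set (Ω → ℝ)))
    (D : (Ω → ℝ) → ℝ)
    (hD : ∀ p ∈ Submodule.span ℝ P,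
      Tendsto (fun t : ℝ => (Φ (q + t • p) - Φ q) / t)
        (nhdsWithin 0 {t : ℝ | t ≠ 0 ∧ q + t • p ∈ predCone P}) (nhds (D p))) :
    (∀ p ∈ Submodule.span ℝ P, ∀ r ∈ Submodule.span ℝ P, D (p + r) = D p + D r) ∧
    (∀ c : ℝ, ∀ p ∈ Submodule.span ℝ P, D (c • p) = c * D p) ∧
    ((∀ p ∈ predCone P, D p ≤ Φ p) ∧ D q = Φ q) ∧
    ∀ L : Submodule.span ℝ P →ₗ[ℝ] ℝ,
      ((∀ p : Ω → ℝ, ∀ hp : p ∈ predCone P, L ⟨p, predCone_subset_span P hp⟩ ≤ Φ p) ∧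
        L ⟨q, predCone_subset_span P hq⟩ = Φ q) →
      ∀ p : Submodule.span ℝ P, L p = D (p : Ω → ℝ) := by
  have hO : ∀ p ∈ Submodule.span ℝ P, p ∈ oSet P q := fun p hp => by
    have hp' := Submodule.neg_mem _ hp
    rw [← SetLike.mem_coe, ← hdir] at hp hp'
    exact ⟨hp, hp'⟩
  have hmem : ∀ p ∈ Submodule.span ℝ P, ∀ᶠ t : ℝ in 𝓝 0, q + t • p ∈ predCone P :=
    fun p hp => eventually_add_smul_mem_predCone hP.1 (hO p hp)
  have hlim : ∀ p ∈ Submodule.span ℝ P,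
      Tendsto (fun t : ℝ => (Φ (q + t • p) - Φ q) / t) (𝓝[≠] 0) (𝓝 (D p)) := fun p hp =>
    (hD p hp).mono_left <| le_inf nhdsWithin_le_nhds <| le_principal_iff.2 <| by
      filter_upwards [self_mem_nhdsWithin, nhdsWithin_le_nhds (hmem p hp)] with t h0 ht
      exact ⟨h0, ht⟩
  have hright : ∀ p ∈ Submodule.span ℝ P,
      Tendsto (fun t : ℝ => (Φ (q + t • p) - Φ q) / t) (𝓝[>] 0) (𝓝 (D p)) := fun p hp =>
    (hlim p hp).mono_left (nhdsWithin_mono _ fun t (ht : 0 < t) => ht.ne')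
  have hcomp : ∀ c : ℝ, c ≠ 0 → Tendsto (fun t : ℝ => c * t) (𝓝[≠] 0) (𝓝[≠] 0) := fun c hc =>
    tendsto_nhdsWithin_of_tendsto_nhds_of_eventually_within _
      (((continuous_const_mul c).tendsto' 0 0 (mul_zero c)).mono_left nhdsWithin_le_nhds)
      (by filter_upwards [self_mem_nhdsWithin] with t ht using mul_ne_zero hc ht)
  have hsmul : ∀ c : ℝ, ∀ p ∈ Submodule.span ℝ P, D (c • p) = c * D p := by
    intro c p hp
    refine tendsto_nhds_unique (hlim _ (Submodule.smul_mem _ c hp)) ?_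
    rcases eq_or_ne c 0 with rfl | hc
    · simp
    · refine (((hlim p hp).comp (hcomp c hc)).const_mul c).congr' ?_
      filter_upwards [self_mem_nhdsWithin] with t ht
      have ht : t ≠ 0 := ht
      simp only [Function.comp_apply, smul_smul, mul_comm t c]
      field_simp
  have hneg : ∀ p ∈ Submodule.span ℝ P, D (-p) = -D p := fun p hp => by
    simpa using hsmul (-1) p hp
  have hsub : ∀ p ∈ Submodule.span ℝ P, ∀ r ∈ Submodule.span ℝ P, D (p + r) ≤ D p + D r := by
    intro p hp r hr
    have h2 : Tendsto (fun t : ℝ => 2 * t) (𝓝[>] 0) (𝓝[≠] 0) :=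
      (hcomp 2 two_ne_zero).mono_left (nhdsWithin_mono _ fun t (ht : 0 < t) => ht.ne')
    refine le_of_tendsto_of_tendsto (hright _ (Submodule.add_mem _ hp hr))
      (((hlim p hp).comp h2).add ((hlim r hr).comp h2)) ?_
    filter_upwards [self_mem_nhdsWithin, (h2.mono_right nhdsWithin_le_nhds).eventually (hmem p hp),
      (h2.mono_right nhdsWithin_le_nhds).eventually (hmem r hr)] with t ht htp htr
    have ht : 0 < t := ht
    have e : q + t • (p + r) = (1 / 2 : ℝ) • (q + (2 * t) • p) + (1 / 2 : ℝ) • (q + (2 * t) • r) := by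
      ext x
      simp only [Pi.add_apply, Pi.smul_apply, smul_eq_mul]
      ring
    have hle := hΦ.2 _ (smul_mem_predCone htp (one_half_pos (α := ℝ)))
      _ (smul_mem_predCone htr (one_half_pos (α := ℝ)))
    rw [← e, hΦ.1 _ htp _ one_half_pos, hΦ.1 _ htr _ one_half_pos] at hle
    simp only [Function.comp_apply]
    rw [← add_div, div_le_div_iff₀ ht (by positivity)]
    nlinarith
  refine ⟨fun p hp r hr => le_antisymm (hsub p hp r hr) ?_, hsmul, ⟨fun p hp => ?_, ?_⟩, ?_⟩
  · have h := hsub _ (Submodule.neg_mem _ hp) _ (Submodule.neg_mem _ hr)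
    rw [← neg_add, hneg _ (Submodule.add_mem _ hp hr), hneg p hp, hneg r hr] at h
    linarith
  · refine le_of_tendsto (hright p (predCone_subset_span P hp)) ?_
    filter_upwards [self_mem_nhdsWithin] with t ht
    have ht : 0 < t := ht
    have h := hΦ.2 q hq _ (smul_mem_predCone hp ht)
    rw [hΦ.1 p hp t ht] at h
    rw [div_le_iff₀ ht]
    linarith
  · refine tendsto_nhds_unique (hright q (predCone_subset_span P hq))
      (tendsto_const_nhds.congr' ?_)
    filter_upwards [self_mem_nhdsWithin] with t ht
    have ht : 0 < t := ht
    have e : q + t • q = (1 + t) • q := by rw [add_smul, one_smul]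
    rw [e, hΦ.1 q hq _ (by positivity)]
    field_simp
    ring
  · rintro L ⟨hL, hLq⟩
    have hle : ∀ p : Submodule.span ℝ P, L p ≤ D (p : Ω → ℝ) := by
      intro p
      refine ge_of_tendsto (hright p p.2) ?_
      filter_upwards [self_mem_nhdsWithin, nhdsWithin_le_nhds (hmem p p.2)] with t ht htp
      have ht : 0 < t := ht
      have h := hL _ htp
      have e : (⟨q + t • (p : Ω → ℝ), predCone_subset_span P htp⟩ : Submodule.span ℝ P) =
          ⟨q, predCone_subset_span P hq⟩ + t • p := rfl
      rw [e, map_add, map_smul, hLq, smul_eq_mul] at h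
      rw [le_div_iff₀ ht]
      linarith
    intro p
    refine le_antisymm (hle p) ?_
    have h := hle (-p)
    rw [map_neg, Submodule.coe_neg, hneg _ p.2] at h
    linarith
end

section
/- Let N be a real normed space, 𝒞 ⊆ N a nonempty open convex cone, and Φ : 𝒞 → ℝ a continuous sublinear function. Then for every q ∈ 𝒞 there exists a continuous linear functional q* ∈ N* such that Φ(p) ≥ q*(p) for all p ∈ 𝒞 and Φ(q) = q*(q); consequently Φ admits a subgradient map S : 𝒞 → N*. -/
open Filter Topology

/-- A sublinear function on a convex cone is convex. -/
theorem convexOn_of_sublinear {E : Type*} [AddCommGroup E] [Module ℝ E]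
    {C : Set E} (hconv : Convex ℝ C)
    (hcone : ∀ c : ℝ, 0 < c → ∀ x ∈ C, c • x ∈ C) {Φ : E → ℝ}
    (hhom : ∀ x ∈ C, ∀ c : ℝ, 0 < c → Φ (c • x) = c * Φ x)
    (hsub : ∀ x ∈ C, ∀ y ∈ C, Φ (x + y) ≤ Φ x + Φ y) : ConvexOn ℝ C Φ := by
  refine convexOn_iff_forall_pos.2 ⟨hconv, fun x hx y hy a b ha hb _ => ?_⟩
  have h := hsub _ (hcone a ha x hx) _ (hcone b hb y hy)
  rwa [hhom x hx a ha, hhom y hy b hb] at h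

/-- The strict epigraph of a continuous function on an open set is open. -/
theorem ContinuousOn.isOpen_strict_epigraph {X : Type*} [TopologicalSpace X]
    {C : Set X} (hopen : IsOpen C) {Φ : X → ℝ} (hcont : ContinuousOn Φ C) :
    IsOpen {z : X × ℝ | z.1 ∈ C ∧ Φ z.1 < z.2} := by
  have h : ContinuousOn (fun z : X × ℝ => z.2 - Φ z.1) (Prod.fst ⁻¹' C) :=
    continuousOn_snd.sub (hcont.comp continuousOn_fst fun _ hz => hz)
  convert h.isOpen_inter_preimage (hopen.preimage continuous_fst) (isOpen_Ioi (a := (0 : ℝ)))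
    using 1
  ext z
  simp

/-- A continuous convex function on an open set has a supporting affine functional at each
point. -/
theorem ConvexOn.exists_affine_support {E : Type*} [NormedAddCommGroup E] [NormedSpace ℝ E]
    {C : Set E} (hopen : IsOpen C) {Φ : E → ℝ} (hΦ : ConvexOn ℝ C Φ)
    (hcont : ContinuousOn Φ C) {q : E} (hq : q ∈ C) :
    ∃ L : E →L[ℝ] ℝ, ∀ p ∈ C, L p - L q ≤ Φ p - Φ q := by
  obtain ⟨f, hf⟩ := geometric_hahn_banach_point_open (x := (q, Φ q)) hΦ.convex_strict_epigraph
    (hcont.isOpen_strict_epigraph hopen) (fun h => lt_irrefl _ h.2)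
  have hsplit (x : E) (t : ℝ) : f (x, t) = f (x, 0) + t * f (0, 1) := by
    rw [← smul_eq_mul, ← map_smul, ← map_add]
    simp
  have hk : 0 < f (0, 1) := by
    have h := hf (q, Φ q + 1) ⟨hq, lt_add_one _⟩
    rw [hsplit, hsplit q (Φ q + 1)] at h
    linarith
  refine ⟨-(f (0, 1))⁻¹ • f.comp (ContinuousLinearMap.inl ℝ E ℝ), fun p hp => ?_⟩
  have key : f (q, 0) - f (p, 0) ≤ (Φ p - Φ q) * f (0, 1) := by
    refine le_of_forall_pos_le_add fun ε hε => ?_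
    have h := hf (p, Φ p + ε / f (0, 1)) ⟨hp, lt_add_of_pos_right _ (div_pos hε hk)⟩
    rw [hsplit, hsplit p, add_mul, div_mul_cancel₀ _ hk.ne'] at h
    linarith
  have h := (div_le_iff₀ hk).2 key
  simp only [smul_apply, ContinuousLinearMap.comp_apply,
    ContinuousLinearMap.inl_apply, smul_eq_mul]
  refine le_trans (le_of_eq ?_) h
  ring

/-- supporting hyperplane theorem. Let `N` be a real normed
space, `C ⊆ N` a nonempty open convex cone and `Φ : C → ℝ` continuous and
sublinear. Then every `q ∈ C` admits a continuous linear functional `L ∈ N*` with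
`L ≤ Φ` on `C` and `L q = Φ q`; consequently `Φ` admits a subgradient map
`S : C → N*`. -/
theorem supporting_hyperplane
    {N : Type*} [NormedAddCommGroup N] [NormedSpace ℝ N]
    (C : Set N) (hne : C.Nonempty) (hopen : IsOpen C) (hconv : Convex ℝ C)
    (hcone : ∀ c : ℝ, 0 < c → ∀ x ∈ C, c • x ∈ C)
    (Φ : N → ℝ) (hcont : ContinuousOn Φ C)
    (hhom : ∀ x ∈ C, ∀ c : ℝ, 0 < c → Φ (c • x) = c * Φ x)
    (hsub : ∀ x ∈ C, ∀ y ∈ C, Φ (x + y) ≤ Φ x + Φ y) :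
    (∀ q ∈ C, ∃ L : N →L[ℝ] ℝ, (∀ p ∈ C, L p ≤ Φ p) ∧ L q = Φ q) ∧
    ∃ S : N → (N →L[ℝ] ℝ), ∀ q ∈ C, (∀ p ∈ C, (S q) p ≤ Φ p) ∧ (S q) q = Φ q := by
  have main : ∀ q ∈ C, ∃ L : N →L[ℝ] ℝ, (∀ p ∈ C, L p ≤ Φ p) ∧ L q = Φ q := by
    intro q hq
    obtain ⟨L, hL⟩ :=
      (convexOn_of_sublinear hconv hcone hhom hsub).exists_affine_support hopen hcont hq
    have hscale (c : ℝ) (hc : 0 < c) : c * L q - L q ≤ c * Φ q - Φ q := by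
      simpa [hhom q hq c hc] using hL (c • q) (hcone c hc q hq)
    have hLq : L q = Φ q := by
      linarith [hscale 2 (by norm_num), hscale (1 / 2) (by norm_num)]
    exact ⟨L, fun p hp => by linarith [hL p hp], hLq⟩
  refine ⟨main, ?_⟩
  choose! S hS using main
  exact ⟨S, hS⟩
end
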